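/- Fix finite nonempty sets 𝒳, 𝒵, a pmf P_X on 𝒳, and a channel W from 𝒳 to 𝒵, and define E_s^iid(P_X,W,R) := min over joint pmfs Q on 𝒳×𝒵 with Q ≪ P_X×W of { D(Q‖P_X×W) + max(R − f(Q‖P_X×W), 0) }. Then for all real R, R' with I(P_X,W) < R < R', one has 0 < E_s^iid(P_X,W,R) < E_s^iid(P_X,W,R'); i.e., E_s^iid is positive and strictly increasing in R for R > I(P_X,W). -/

import Mathlib

open Filter

noncomputable section

/-- A probability mass function on a finite alphabet. -/
def IsPMF {α : Type*} [Fintype α] (p : α → ℝ) : Prop :=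
  (∀ a, 0 ≤ p a) ∧ ∑ a, p a = 1

/-- A channel from `𝒳` to `𝒵`: each input is mapped to a pmf on `𝒵`. -/
def IsChannel {𝒳 𝒵 : Type*} [Fintype 𝒵] (W : 𝒳 → 𝒵 → ℝ) : Prop :=
  ∀ x, IsPMF (W x)

/-- Absolute continuity: `Q a > 0` implies `Q' a > 0`. -/
def AbsCont {α : Type*} (Q Q' : α → ℝ) : Prop :=
  ∀ a, 0 < Q a → 0 < Q' a

/-- Kullback–Leibler divergence `D(Q‖Q')` (the sum over the support of `Q`). -/
def klDiv {α : Type*} [Fintype α] (Q Q' : α → ℝ) : ℝ :=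
  ∑ a, if 0 < Q a then Q a * Real.log (Q a / Q' a) else 0

/-- `x`-marginal of a joint distribution. -/
def margX {𝒳 𝒵 : Type*} [Fintype 𝒵] (Q : 𝒳 × 𝒵 → ℝ) : 𝒳 → ℝ :=
  fun x => ∑ z, Q (x, z)

/-- `z`-marginal of a joint distribution. -/
def margZ {𝒳 𝒵 : Type*} [Fintype 𝒳] (Q : 𝒳 × 𝒵 → ℝ) : 𝒵 → ℝ :=
  fun z => ∑ x, Q (x, z)

/-- The joint pmf `(x,z) ↦ P(x) W(z|x)`. -/
def jointPW {𝒳 𝒵 : Type*} (P : 𝒳 → ℝ) (W : 𝒳 → 𝒵 → ℝ) : 𝒳 × 𝒵 → ℝ :=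
  fun p => P p.1 * W p.1 p.2

/-- The function `f(Q‖Q') = Σ_{Q(x,z)>0} Q(x,z) ln( Q'(x,z) / (Q'_X(x) Q'_Z(z)) )`. -/
def fFun {𝒳 𝒵 : Type*} [Fintype 𝒳] [Fintype 𝒵] (Q Q' : 𝒳 × 𝒵 → ℝ) : ℝ :=
  ∑ p, if 0 < Q p then Q p * Real.log (Q' p / (margX Q' p.1 * margZ Q' p.2)) else 0

/-- The output distribution `(P∘W)(z) = Σ_x P(x)W(z|x)`. -/
def outDist {𝒳 𝒵 : Type*} [Fintype 𝒳] (P : 𝒳 → ℝ) (W : 𝒳 → 𝒵 → ℝ) : 𝒵 → ℝ :=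
  fun z => ∑ x, P x * W x z

/-- Mutual information `I(P,W)` developed across the channel `W` with input `P`. -/
def mutInfo {𝒳 𝒵 : Type*} [Fintype 𝒳] [Fintype 𝒵] (P : 𝒳 → ℝ) (W : 𝒳 → 𝒵 → ℝ) : ℝ :=
  ∑ p : 𝒳 × 𝒵, if 0 < P p.1 * W p.1 p.2 then
    P p.1 * W p.1 p.2 * Real.log (W p.1 p.2 / outDist P W p.2) else 0

/-- The exact i.i.d. secrecy/resolvability exponent. -/
def EsIID {𝒳 𝒵 : Type*} [Fintype 𝒳] [Fintype 𝒵] (P : 𝒳 → ℝ) (W : 𝒳 → 𝒵 → ℝ) (R : ℝ) : ℝ :=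
  sInf { e : ℝ | ∃ Q : 𝒳 × 𝒵 → ℝ, IsPMF Q ∧ AbsCont Q (jointPW P W) ∧
    e = klDiv Q (jointPW P W) + max (R - fFun Q (jointPW P W)) 0 }

theorem klDiv_eq_sum_sub {α : Type*} [Fintype α] {Q V : α → ℝ} (hQ : ∀ a, 0 ≤ Q a)
    (hac : AbsCont Q V) :
    klDiv Q V = ∑ a, (Q a * Real.log (Q a) - Q a * Real.log (V a)) := by
  refine Finset.sum_congr rfl fun a _ => ?_
  split_ifs with h
  · rw [Real.log_div h.ne' (hac a h).ne', mul_sub]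
  · simp [le_antisymm (not_lt.1 h) (hQ a)]

theorem fFun_eq_sum {𝒳 𝒵 : Type*} [Fintype 𝒳] [Fintype 𝒵] {Q : 𝒳 × 𝒵 → ℝ}
    (hQ : ∀ p, 0 ≤ Q p) (V : 𝒳 × 𝒵 → ℝ) :
    fFun Q V = ∑ p, Q p * Real.log (V p / (margX V p.1 * margZ V p.2)) := by
  refine Finset.sum_congr rfl fun p _ => ?_
  split_ifs with h
  · rfl
  · simp [le_antisymm (not_lt.1 h) (hQ p)]

theorem sub_le_mul_log_sub {q v : ℝ} (hq : 0 ≤ q) (hv : 0 ≤ v) (hqv : 0 < q → 0 < v) :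
    q - v ≤ q * Real.log q - q * Real.log v := by
  rcases hq.eq_or_lt with rfl | hq
  · simpa using hv
  · have hv := hqv hq
    have h := Real.log_le_sub_one_of_pos (div_pos hv hq)
    rw [Real.log_div hv.ne' hq.ne'] at h
    have h2 := mul_le_mul_of_nonneg_left h hq.le
    rw [mul_sub, mul_sub, mul_div_cancel₀ _ hq.ne'] at h2
    linarith

theorem sub_lt_mul_log_sub {q v : ℝ} (hq : 0 ≤ q) (hv : 0 ≤ v) (hqv : 0 < q → 0 < v)
    (hne : q ≠ v) : q - v < q * Real.log q - q * Real.log v := by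
  rcases hq.eq_or_lt with rfl | hq
  · simpa using lt_of_le_of_ne hv hne
  · have hv := hqv hq
    have h := Real.log_lt_sub_one_of_pos (div_pos hv hq)
      (fun h => hne ((div_eq_one_iff_eq hq.ne').1 h).symm)
    rw [Real.log_div hv.ne' hq.ne'] at h
    have h2 := mul_lt_mul_of_pos_left h hq
    rw [mul_sub, mul_sub, mul_div_cancel₀ _ hq.ne'] at h2
    linarith

theorem klDiv_nonneg_of_isPMF {α : Type*} [Fintype α] {Q V : α → ℝ} (hQ : IsPMF Q) (hV : IsPMF V)
    (hac : AbsCont Q V) : 0 ≤ klDiv Q V := by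
  rw [klDiv_eq_sum_sub hQ.1 hac]
  calc (0 : ℝ) = ∑ a, (Q a - V a) := by rw [Finset.sum_sub_distrib, hQ.2, hV.2, sub_self]
    _ ≤ _ := Finset.sum_le_sum fun a _ => sub_le_mul_log_sub (hQ.1 a) (hV.1 a) (hac a)

theorem klDiv_pos_of_ne {α : Type*} [Fintype α] {Q V : α → ℝ} (hQ : IsPMF Q) (hV : IsPMF V)
    (hac : AbsCont Q V) (hne : Q ≠ V) : 0 < klDiv Q V := by
  obtain ⟨b, hb⟩ := Function.ne_iff.1 hne
  rw [klDiv_eq_sum_sub hQ.1 hac]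
  calc (0 : ℝ) = ∑ a, (Q a - V a) := by rw [Finset.sum_sub_distrib, hQ.2, hV.2, sub_self]
    _ < _ := Finset.sum_lt_sum
      (fun a _ => sub_le_mul_log_sub (hQ.1 a) (hV.1 a) (hac a))
      ⟨b, Finset.mem_univ b, sub_lt_mul_log_sub (hQ.1 b) (hV.1 b) (hac b) hb⟩

/-- The mixture `(1 - s) V + s Q`. -/
def mixture {α : Type*} (s : ℝ) (V Q : α → ℝ) : α → ℝ :=
  fun a => (1 - s) * V a + s * Q a

theorem IsPMF.mixture {α : Type*} [Fintype α] {s : ℝ} {V Q : α → ℝ} (hV : IsPMF V) (hQ : IsPMF Q)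
    (hs0 : 0 ≤ s) (hs1 : s ≤ 1) : IsPMF (mixture s V Q) := by
  refine ⟨fun a => add_nonneg (mul_nonneg (sub_nonneg.2 hs1) (hV.1 a))
    (mul_nonneg hs0 (hQ.1 a)), ?_⟩
  simp only [_root_.mixture, Finset.sum_add_distrib, ← Finset.mul_sum, hV.2, hQ.2]
  ring

theorem AbsCont.mixture {α : Type*} {s : ℝ} {V Q : α → ℝ} (hV : ∀ a, 0 ≤ V a)
    (hQ : ∀ a, 0 ≤ Q a) (hac : AbsCont Q V) : AbsCont (mixture s V Q) V := by
  intro a ha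
  by_contra h
  have hVa : V a = 0 := le_antisymm (not_lt.1 h) (hV a)
  have hQa : Q a = 0 := le_antisymm (not_lt.1 fun hq => h (hac a hq)) (hQ a)
  simp [_root_.mixture, hVa, hQa] at ha

theorem klDiv_mixture_le {α : Type*} [Fintype α] {s : ℝ} {V Q : α → ℝ} (hV : IsPMF V)
    (hQ : IsPMF Q) (hac : AbsCont Q V) (hs0 : 0 ≤ s) (hs1 : s ≤ 1) :
    klDiv (mixture s V Q) V ≤ s * klDiv Q V := by
  rw [klDiv_eq_sum_sub (hV.mixture hQ hs0 hs1).1 (hac.mixture hV.1 hQ.1),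
    klDiv_eq_sum_sub hQ.1 hac, Finset.mul_sum]
  refine Finset.sum_le_sum fun a _ => ?_
  have h := Real.convexOn_mul_log.2 (Set.mem_Ici.2 (hV.1 a)) (Set.mem_Ici.2 (hQ.1 a))
    (sub_nonneg.2 hs1) hs0 (by ring)
  simp only [smul_eq_mul] at h
  simp only [mixture]
  linarith

theorem fFun_mixture {𝒳 𝒵 : Type*} [Fintype 𝒳] [Fintype 𝒵] {s : ℝ} {V Q : 𝒳 × 𝒵 → ℝ}
    (hV : IsPMF V) (hQ : IsPMF Q) (hs0 : 0 ≤ s) (hs1 : s ≤ 1) :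
    fFun (mixture s V Q) V = (1 - s) * fFun V V + s * fFun Q V := by
  rw [fFun_eq_sum (hV.mixture hQ hs0 hs1).1, fFun_eq_sum hV.1, fFun_eq_sum hQ.1, Finset.mul_sum,
    Finset.mul_sum, ← Finset.sum_add_distrib]
  refine Finset.sum_congr rfl fun p _ => ?_
  simp only [mixture]
  ring

theorem isPMF_jointPW {𝒳 𝒵 : Type*} [Fintype 𝒳] [Fintype 𝒵] {P : 𝒳 → ℝ} {W : 𝒳 → 𝒵 → ℝ}
    (hP : IsPMF P) (hW : IsChannel W) : IsPMF (jointPW P W) := by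
  refine ⟨fun p => mul_nonneg (hP.1 _) ((hW _).1 _), ?_⟩
  simp only [jointPW, Fintype.sum_prod_type, ← Finset.mul_sum, (hW _).2, mul_one, hP.2]

theorem fFun_jointPW_self {𝒳 𝒵 : Type*} [Fintype 𝒳] [Fintype 𝒵] (P : 𝒳 → ℝ) {W : 𝒳 → 𝒵 → ℝ}
    (hW : IsChannel W) :
    fFun (jointPW P W) (jointPW P W) = mutInfo P W := by
  have hX : ∀ x, margX (jointPW P W) x = P x := fun x => by
    simp only [margX, jointPW, ← Finset.mul_sum, (hW x).2, mul_one]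
  refine Finset.sum_congr rfl fun p _ => ?_
  change (if 0 < P p.1 * W p.1 p.2 then P p.1 * W p.1 p.2 *
    Real.log (P p.1 * W p.1 p.2 / (margX (jointPW P W) p.1 * outDist P W p.2)) else 0) = _
  split_ifs with h
  · have hp : P p.1 ≠ 0 := by
      rintro h0
      simp [h0] at h
    rw [hX, mul_div_mul_left _ _ hp]
  · rfl

theorem klDiv_self {α : Type*} [Fintype α] {V : α → ℝ} (hV : ∀ a, 0 ≤ V a) : klDiv V V = 0 := by
  rw [klDiv_eq_sum_sub hV fun _ h => h]
  simp

theorem isCompact_setOf_isPMF_absCont {α : Type*} [Fintype α] {V : α → ℝ} (hV : ∀ a, 0 ≤ V a) :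
    IsCompact {Q : α → ℝ | IsPMF Q ∧ AbsCont Q V} := by
  have hset : {Q : α → ℝ | IsPMF Q ∧ AbsCont Q V} =
      stdSimplex ℝ α ∩ ⋂ a, {Q | V a = 0 → Q a = 0} := by
    ext Q
    simp only [Set.mem_inter_iff, Set.mem_iInter, Set.mem_ofPred_eq]
    refine and_congr_right fun hQ => forall_congr' fun a => ⟨fun h h0 => ?_, fun h hq => ?_⟩
    · exact le_antisymm (not_lt.1 fun hq => (h hq).ne' h0) (hQ.1 a)
    · exact lt_of_le_of_ne (hV a) fun h0 => hq.ne' (h h0.symm)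
  rw [hset]
  refine (isCompact_stdSimplex ℝ α).inter_right (isClosed_iInter fun a => ?_)
  by_cases h : V a = 0
  · simpa [h] using isClosed_eq (continuous_apply a) continuous_const
  · simp [h]

theorem exists_minimizer_EsIID {𝒳 𝒵 : Type*} [Fintype 𝒳] [Fintype 𝒵] {P : 𝒳 → ℝ}
    {W : 𝒳 → 𝒵 → ℝ} (hP : IsPMF P) (hW : IsChannel W) (R : ℝ) :
    ∃ Q : 𝒳 × 𝒵 → ℝ, IsPMF Q ∧ AbsCont Q (jointPW P W) ∧
      EsIID P W R = klDiv Q (jointPW P W) + max (R - fFun Q (jointPW P W)) 0 ∧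
      ∀ Q' : 𝒳 × 𝒵 → ℝ, IsPMF Q' → AbsCont Q' (jointPW P W) →
        EsIID P W R ≤ klDiv Q' (jointPW P W) + max (R - fFun Q' (jointPW P W)) 0 := by
  have hV := isPMF_jointPW hP hW
  set V := jointPW P W with hVdef
  have hcont : ContinuousOn (fun Q => klDiv Q V + max (R - fFun Q V) 0)
      {Q : 𝒳 × 𝒵 → ℝ | IsPMF Q ∧ AbsCont Q V} := by
    have hc : Continuous fun Q : 𝒳 × 𝒵 → ℝ =>
        ∑ a, (Q a * Real.log (Q a) - Q a * Real.log (V a)) +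
        max (R - ∑ p, Q p * Real.log (V p / (margX V p.1 * margZ V p.2))) 0 := by
      have hl (a : 𝒳 × 𝒵) : Continuous fun Q : 𝒳 × 𝒵 → ℝ => Q a * Real.log (Q a) :=
        Real.continuous_mul_log.comp (continuous_apply a)
      fun_prop
    refine hc.continuousOn.congr fun Q hQ => ?_
    simp only [klDiv_eq_sum_sub hQ.1.1 hQ.2, fFun_eq_sum hQ.1.1]
  obtain ⟨Q, hQ, hmin⟩ := (isCompact_setOf_isPMF_absCont hV.1).exists_isMinOn
    ⟨V, hV, fun _ h => h⟩ hcont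
  have hleast : IsLeast { e : ℝ | ∃ Q : 𝒳 × 𝒵 → ℝ, IsPMF Q ∧ AbsCont Q V ∧
      e = klDiv Q V + max (R - fFun Q V) 0 } (klDiv Q V + max (R - fFun Q V) 0) := by
    refine ⟨⟨Q, hQ.1, hQ.2, rfl⟩, ?_⟩
    rintro _ ⟨Q', h1, h2, rfl⟩
    exact hmin ⟨h1, h2⟩
  have heq : EsIID P W R = klDiv Q V + max (R - fFun Q V) 0 := hleast.csInf_eq
  exact ⟨Q, hQ.1, hQ.2, heq, fun Q' h1 h2 => heq ▸ hmin ⟨h1, h2⟩⟩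

theorem EsIID_pos {𝒳 𝒵 : Type*} [Fintype 𝒳] [Fintype 𝒵] {P : 𝒳 → ℝ} {W : 𝒳 → 𝒵 → ℝ}
    (hP : IsPMF P) (hW : IsChannel W) {R : ℝ} (hR : mutInfo P W < R) : 0 < EsIID P W R := by
  obtain ⟨Q, hQ, hac, heq, -⟩ := exists_minimizer_EsIID hP hW R
  have hV := isPMF_jointPW hP hW
  rw [heq]
  by_cases hne : Q = jointPW P W
  · rw [hne, klDiv_self hV.1, fFun_jointPW_self P hW, zero_add]
    exact lt_max_of_lt_left (sub_pos.2 hR)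
  · exact add_pos_of_pos_of_nonneg (klDiv_pos_of_ne hQ hV hac hne) (le_max_right _ _)

theorem EsIID_convexComb_le {𝒳 𝒵 : Type*} [Fintype 𝒳] [Fintype 𝒵] {P : 𝒳 → ℝ} {W : 𝒳 → 𝒵 → ℝ}
    (hP : IsPMF P) (hW : IsChannel W) {s : ℝ} (hs0 : 0 ≤ s) (hs1 : s ≤ 1) (R : ℝ) :
    EsIID P W ((1 - s) * mutInfo P W + s * R) ≤ s * EsIID P W R := by
  obtain ⟨Q, hQ, hac, heq, -⟩ := exists_minimizer_EsIID hP hW R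
  obtain ⟨-, -, -, -, hle⟩ := exists_minimizer_EsIID hP hW ((1 - s) * mutInfo P W + s * R)
  have hV := isPMF_jointPW hP hW
  refine (hle _ (hV.mixture hQ hs0 hs1) (hac.mixture hV.1 hQ.1)).trans ?_
  rw [heq, mul_add, fFun_mixture hV hQ hs0 hs1, fFun_jointPW_self P hW, add_sub_add_left_eq_sub,
    ← mul_sub, mul_max_of_nonneg _ _ hs0, mul_zero]
  gcongr
  exact klDiv_mixture_le hV hQ hac hs0 hs1

theorem EsIID_pos_and_strictMono
    {𝒳 𝒵 : Type*} [Fintype 𝒳] [Fintype 𝒵] [Nonempty 𝒳] [Nonempty 𝒵]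
    (P_X : 𝒳 → ℝ) (W : 𝒳 → 𝒵 → ℝ) (hP : IsPMF P_X) (hW : IsChannel W)
    (R R' : ℝ) (hR : mutInfo P_X W < R) (hRR' : R < R') :
    0 < EsIID P_X W R ∧ EsIID P_X W R < EsIID P_X W R' := by
  refine ⟨EsIID_pos hP hW hR, ?_⟩
  set I := mutInfo P_X W with hI
  have hd : 0 < R' - I := by linarith
  have hs1 : (R - I) / (R' - I) < 1 := (div_lt_one hd).2 (by linarith)
  have h := EsIID_convexComb_le hP hW (div_nonneg (sub_nonneg.2 hR.le) hd.le) hs1.le R'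
  have hcomb : (1 - (R - I) / (R' - I)) * I + (R - I) / (R' - I) * R' = R := by
    field_simp
    ring
  rw [← hI, hcomb] at h
  exact h.trans_lt (mul_lt_of_lt_one_left (EsIID_pos hP hW (hR.trans hRR')) hs1)

end
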